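/- (Monotonicity of the posterior variance in the data.) Let X_t = (x_1,…,x_t) be a tuple of points of 𝒳, let Σ = diag(λ_1²,…,λ_t²) with λ_i > 0 for all i ∈ [t], let S ⊆ [t], and let X_S denote the sub-tuple (x_i)_{i∈S} and Σ_S := diag((λ_i²)_{i∈S}). Then for every x ∈ 𝒳, σ²_Σ(x; X_t) ≤ σ²_{Σ_S}(x; X_S). -/

import Mathlib

open Matrix Real Finset

noncomputable section

universe u

/-- Gram (kernel) matrix of a finite tuple of points. -/
def gramMat {𝒳 : Type u} (k : 𝒳 → 𝒳 → ℝ) {m : ℕ} (X : Fin m → 𝒳) :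
    Matrix (Fin m) (Fin m) ℝ :=
  Matrix.of fun i j => k (X i) (X j)

/-- Kernel vector `k(x, X)`. -/
def kVec {𝒳 : Type u} (k : 𝒳 → 𝒳 → ℝ) {m : ℕ} (X : Fin m → 𝒳) (x : 𝒳) : Fin m → ℝ :=
  fun i => k x (X i)

/-- Posterior variance `σ²_Σ(x; X)`. -/
def postVar {𝒳 : Type u} (k : 𝒳 → 𝒳 → ℝ) {m : ℕ} (S : Matrix (Fin m) (Fin m) ℝ)
    (X : Fin m → 𝒳) (x : 𝒳) : ℝ :=
  k x x - kVec k X x ⬝ᵥ ((gramMat k X + S)⁻¹ *ᵥ kVec k X x)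

/-- Posterior standard deviation `σ_Σ(x; X)`. -/
def postStd {𝒳 : Type u} (k : 𝒳 → 𝒳 → ℝ) {m : ℕ} (S : Matrix (Fin m) (Fin m) ℝ)
    (X : Fin m → 𝒳) (x : 𝒳) : ℝ :=
  Real.sqrt (postVar k S X x)

/-- Posterior mean `μ_Σ(x; X, y)`. -/
def postMean {𝒳 : Type u} (k : 𝒳 → 𝒳 → ℝ) {m : ℕ} (S : Matrix (Fin m) (Fin m) ℝ)
    (X : Fin m → 𝒳) (y : Fin m → ℝ) (x : 𝒳) : ℝ :=
  kVec k X x ⬝ᵥ ((gramMat k X + S)⁻¹ *ᵥ y)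

/-- Information gain `I_Σ(Z)`. -/
def infoGain {𝒳 : Type u} (k : 𝒳 → 𝒳 → ℝ) {m : ℕ} (S : Matrix (Fin m) (Fin m) ℝ)
    (Z : Fin m → 𝒳) : ℝ :=
  (1 / 2) * Real.log ((S + gramMat k Z).det / S.det)

/-- `k` is a symmetric positive semidefinite kernel. -/
def IsKernel {𝒳 : Type u} (k : 𝒳 → 𝒳 → ℝ) : Prop :=
  (∀ x y, k x y = k y x) ∧ ∀ (m : ℕ) (Z : Fin m → 𝒳), (gramMat k Z).PosSemidef

/-- Prefix of length `t` of a sequence of points. -/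
def preT {𝒳 : Type u} (x : ℕ → 𝒳) (t : ℕ) : Fin t → 𝒳 := fun i => x i.val

/-- Variational lower bound for the quadratic form of the inverse of a positive definite matrix. -/
lemma Matrix.PosDef.two_mul_dotProduct_sub_le {m : Type*} [Fintype m] [DecidableEq m]
    {A : Matrix m m ℝ} (hA : A.PosDef) (v w : m → ℝ) :
    2 * (w ⬝ᵥ v) - w ⬝ᵥ (A *ᵥ w) ≤ v ⬝ᵥ (A⁻¹ *ᵥ v) := by
  have hAv : A *ᵥ (A⁻¹ *ᵥ v) = v := by
    rw [mulVec_mulVec, mul_nonsing_inv _ ((isUnit_iff_isUnit_det A).mp hA.isUnit), one_mulVec]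
  have hsymm : Aᵀ = A := by simpa using hA.isHermitian.eq
  have hcross : (A⁻¹ *ᵥ v) ⬝ᵥ (A *ᵥ w) = w ⬝ᵥ v := by
    rw [dotProduct_mulVec, ← mulVec_transpose, hsymm, hAv, dotProduct_comm]
  have hnonneg := hA.posSemidef.dotProduct_mulVec_nonneg (A⁻¹ *ᵥ v - w)
  simp only [star_trivial, mulVec_sub, hAv, sub_dotProduct, dotProduct_sub, hcross] at hnonneg
  rw [dotProduct_comm v]
  linarith

/-- The quadratic form of the inverse of a positive definite matrix decreases on passing to a
principal submatrix. -/
lemma Matrix.PosDef.dotProduct_inv_submatrix_le {m n : Type*} [Fintype m] [DecidableEq m]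
    [Fintype n] [DecidableEq n] {A : Matrix m m ℝ} (hA : A.PosDef) {e : n → m}
    (he : Function.Injective e) (v : m → ℝ) :
    (v ∘ e) ⬝ᵥ ((A.submatrix e e)⁻¹ *ᵥ (v ∘ e)) ≤ v ⬝ᵥ (A⁻¹ *ᵥ v) := by
  have hB : (A.submatrix e e).PosDef := hA.submatrix he
  set w := (A.submatrix e e)⁻¹ *ᵥ (v ∘ e) with hw
  have hBw : A.submatrix e e *ᵥ w = v ∘ e := by
    rw [hw, mulVec_mulVec, mul_nonsing_inv _ ((isUnit_iff_isUnit_det _).mp hB.isUnit),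
      one_mulVec]
  set P : Matrix m n ℝ := (1 : Matrix m m ℝ).submatrix id e with hP
  have hPdot (z : m → ℝ) : (P *ᵥ w) ⬝ᵥ z = w ⬝ᵥ (z ∘ e) := by
    rw [dotProduct_comm, dotProduct_mulVec, dotProduct_comm]
    congr 1
    ext j
    simp [hP, vecMul, dotProduct, one_apply]
  have hAP : (A *ᵥ (P *ᵥ w)) ∘ e = v ∘ e := by
    rw [← hBw, mulVec_mulVec]
    ext i
    simp [hP, mulVec, dotProduct, mul_apply, one_apply]
  have h := hA.two_mul_dotProduct_sub_le v (P *ᵥ w)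
  rw [hPdot, hPdot, hAP] at h
  rw [dotProduct_comm (v ∘ e)]
  linarith

/-- monotonicity of the posterior variance in the data. -/
theorem postVar_mono_data
    {𝒳 : Type u} (k : 𝒳 → 𝒳 → ℝ) (hk : IsKernel k)
    (t : ℕ) (X : Fin t → 𝒳) (lam : Fin t → ℝ) (hpos : ∀ i, 0 < lam i)
    (S : Finset (Fin t)) :
    ∀ x : 𝒳,
      postVar k (Matrix.diagonal fun i => lam i ^ 2) X x
        ≤ postVar k
            (Matrix.diagonal fun j : Fin S.card => lam ((S.orderIsoOfFin rfl j : Fin t)) ^ 2)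
            (fun j : Fin S.card => X ((S.orderIsoOfFin rfl j : Fin t))) x := by
  intro x
  have hA : (gramMat k X + diagonal fun i => lam i ^ 2).PosDef :=
    (PosDef.diagonal fun i => pow_pos (hpos i) 2).posSemidef_add (hk.2 t X)
  have he : Function.Injective fun j : Fin S.card => (S.orderIsoOfFin rfl j : Fin t) :=
    Subtype.val_injective.comp (S.orderIsoOfFin rfl).injective
  have h := hA.dotProduct_inv_submatrix_le he (kVec k X x)
  rw [submatrix_add, Pi.add_apply, Pi.add_apply, submatrix_diagonal _ _ he] at h
  exact sub_le_sub_left h _
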